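/- arXiv:2008.12167 — 4 statements merged into one kernel-verified Lean document; each statement's English description precedes it below -/
import Mathlib

section
/- For every sequence c = (c(1),…,c(n)) of nonnegative integers with ∑_{i=1}^n c(i) = n−1, the number of rooted labeled trees t on vertex set [n] whose child sequence equals c is the multinomial coefficient (n−1)!/(c(1)!·c(2)!·…·c(n)!). -/
open Classical

namespace TWG

/-- `(root, par)` encodes a rooted labeled tree on `Fin n`: the root is a fixed point of
the parent map and every vertex reaches the root by iterating the parent map. -/
def IsRootedTree {n : ℕ} (root : Fin n) (par : Fin n → Fin n) : Prop :=
  par root = root ∧ ∀ v, ∃ m, par^[m] v = root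

/-- The number of children of `i` in the rooted tree `(root, par)`. -/
noncomputable def childCount {n : ℕ} (root : Fin n) (par : Fin n → Fin n) (i : Fin n) : ℕ :=
  Nat.card {v : Fin n // v ≠ root ∧ par v = i}

theorem childCount_eq_sum {n : ℕ} (r : Fin n) (f : Fin n → Fin n) (i : Fin n) :
    childCount r f i = ∑ v, if v ≠ r ∧ f v = i then 1 else 0 := by
  unfold childCount
  rw [Nat.card_eq_fintype_card, Fintype.card_subtype, Finset.card_filter]

/-- Attach a new leaf `l` with parent `p`. -/
def attach {n : ℕ} (l : Fin (n+1)) (p : Fin n) (f : Fin n → Fin n) : Fin (n+1) → Fin (n+1) :=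
  l.insertNth (l.succAbove p) (fun v => l.succAbove (f v))

theorem attach_leaf {n : ℕ} (l : Fin (n+1)) (p : Fin n) (f : Fin n → Fin n) :
    attach l p f l = l.succAbove p := by simp [attach]

theorem attach_old {n : ℕ} (l : Fin (n+1)) (p : Fin n) (f : Fin n → Fin n) (v : Fin n) :
    attach l p f (l.succAbove v) = l.succAbove (f v) := by simp [attach]

theorem attach_iterate {n : ℕ} (l : Fin (n+1)) (p : Fin n) (f : Fin n → Fin n) (m : ℕ)
    (v : Fin n) : (attach l p f)^[m] (l.succAbove v) = l.succAbove (f^[m] v) := by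
  induction m generalizing v with
  | zero => rfl
  | succ m ih => rw [Function.iterate_succ_apply, Function.iterate_succ_apply, attach_old, ih]

theorem attach_tree {n : ℕ} (l : Fin (n+1)) (p r : Fin n) (f : Fin n → Fin n) :
    IsRootedTree (l.succAbove r) (attach l p f) ↔ IsRootedTree r f := by
  unfold IsRootedTree
  rw [attach_old, Fin.succAbove_right_inj]
  refine and_congr_right fun _ => ⟨fun h v => ?_, fun h v => ?_⟩
  · obtain ⟨m, hm⟩ := h (l.succAbove v)
    rw [attach_iterate, Fin.succAbove_right_inj] at hm
    exact ⟨m, hm⟩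
  · rcases Fin.eq_self_or_eq_succAbove l v with rfl | ⟨w, rfl⟩
    · obtain ⟨m, hm⟩ := h p
      refine ⟨m + 1, ?_⟩
      rw [Function.iterate_succ_apply, attach_leaf, attach_iterate, hm]
    · obtain ⟨m, hm⟩ := h w
      exact ⟨m, by rw [attach_iterate, hm]⟩

theorem childCount_attach_old {n : ℕ} (l : Fin (n+1)) (p r : Fin n) (f : Fin n → Fin n)
    (i : Fin n) : childCount (l.succAbove r) (attach l p f) (l.succAbove i)
      = childCount r f i + if i = p then 1 else 0 := by
  rw [childCount_eq_sum, childCount_eq_sum, Fin.sum_univ_succAbove _ l, add_comm]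
  simp only [attach_leaf, attach_old, ne_eq, Fin.succAbove_right_inj]
  congr 1
  have : ¬ l = l.succAbove r := (Fin.succAbove_ne l r).symm
  simp [this, eq_comm]

theorem childCount_attach_leaf {n : ℕ} (l : Fin (n+1)) (p r : Fin n) (f : Fin n → Fin n) :
    childCount (l.succAbove r) (attach l p f) l = 0 := by
  rw [childCount_eq_sum, Fin.sum_univ_succAbove _ l]
  simp [attach_leaf, attach_old, Fin.succAbove_ne]

theorem exists_attach {n : ℕ} (l : Fin (n+2)) (R : Fin (n+2)) (F : Fin (n+2) → Fin (n+2))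
    (hT : IsRootedTree R F) (h0 : childCount R F l = 0) :
    ∃ (p r : Fin (n+1)) (f : Fin (n+1) → Fin (n+1)), l.succAbove r = R ∧ attach l p f = F := by
  have hF : ∀ v, F v = l → v = R := by
    intro v hv
    by_contra hne
    rw [childCount_eq_sum, Finset.sum_eq_zero_iff] at h0
    have := h0 v (Finset.mem_univ _)
    simp [hne, hv] at this
  have hR : R ≠ l := by
    rintro rfl
    have key : ∀ m v, F^[m] v = R → v = R := by
      intro m
      induction m with
      | zero => intro v h; exact h
      | succ m ih =>
        intro v h
        rw [Function.iterate_succ_apply] at h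
        exact hF v (ih _ h)
    obtain ⟨v, hv⟩ := exists_ne R
    obtain ⟨m, hm⟩ := hT.2 v
    exact hv (key m v hm)
  have hl : ∀ v, F v ≠ l := by
    intro v hv
    have := hF v hv
    subst this
    exact hR (hT.1.symm.trans hv)
  obtain ⟨r, hr⟩ := Fin.exists_succAbove_eq hR
  choose g hg using fun v => Fin.exists_succAbove_eq (hl v)
  refine ⟨g l, r, fun v => g (l.succAbove v), hr, ?_⟩
  funext v
  rcases Fin.eq_self_or_eq_succAbove l v with rfl | ⟨w, rfl⟩
  · rw [attach_leaf, hg]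
  · rw [attach_old, hg]

theorem card_step {n : ℕ} (l : Fin (n+2)) (c : Fin (n+2) → ℕ) (hl : c l = 0) :
    Nat.card {t : Fin (n+2) × (Fin (n+2) → Fin (n+2)) //
        IsRootedTree t.1 t.2 ∧ ∀ i, childCount t.1 t.2 i = c i}
    = ∑ p : Fin (n+1), Nat.card {t : Fin (n+1) × (Fin (n+1) → Fin (n+1)) //
        IsRootedTree t.1 t.2 ∧ ∀ i, childCount t.1 t.2 i + (if i = p then 1 else 0)
          = c (l.succAbove i)} := by
  rw [← Nat.card_sigma]
  symm
  refine Nat.card_congr (Equiv.ofBijective (fun x =>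
    ⟨(l.succAbove x.2.1.1, attach l x.1 x.2.1.2), (attach_tree _ _ _ _).2 x.2.2.1, ?_⟩) ⟨?_, ?_⟩)
  · intro i
    rcases Fin.eq_self_or_eq_succAbove l i with rfl | ⟨w, rfl⟩
    · rw [childCount_attach_leaf, hl]
    · rw [childCount_attach_old]; exact x.2.2.2 w
  · rintro ⟨p, ⟨r, f⟩, h⟩ ⟨p', ⟨r', f'⟩, h'⟩ he
    simp only [Subtype.mk.injEq, Prod.mk.injEq, Fin.succAbove_right_inj] at he
    obtain ⟨rfl, h2⟩ := he
    have hp : p = p' := by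
      have := congrFun h2 l
      rwa [attach_leaf, attach_leaf, Fin.succAbove_right_inj] at this
    have hf : f = f' := by
      funext v
      have := congrFun h2 (l.succAbove v)
      rwa [attach_old, attach_old, Fin.succAbove_right_inj] at this
    subst hp hf
    rfl
  · rintro ⟨⟨R, F⟩, hT, hc⟩
    obtain ⟨p, r, f, rfl, rfl⟩ := exists_attach l R F hT ((hc l).trans hl)
    refine ⟨⟨p, ⟨(r, f), (attach_tree _ _ _ _).1 hT, fun i => ?_⟩⟩, rfl⟩
    rw [← hc, childCount_attach_old]

theorem main_aux (n : ℕ) : ∀ (c : Fin (n+1) → ℕ), ∑ i, c i = n →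
    Nat.card {t : Fin (n+1) × (Fin (n+1) → Fin (n+1)) //
        IsRootedTree t.1 t.2 ∧ ∀ i, childCount t.1 t.2 i = c i}
      * ∏ i, Nat.factorial (c i) = Nat.factorial n := by
  induction n with
  | zero =>
    intro c hc
    have h0 : ∀ i, c i = 0 := by simpa using hc
    have : Nat.card {t : Fin (0+1) × (Fin (0+1) → Fin (0+1)) //
        IsRootedTree t.1 t.2 ∧ ∀ i, childCount t.1 t.2 i = c i} = 1 := by
      rw [Nat.card_eq_one_iff_unique]
      refine ⟨⟨fun a b => Subtype.ext (Prod.ext (Subsingleton.elim (α := Fin 1) _ _) (funext fun _ => Subsingleton.elim (α := Fin 1) _ _))⟩, ⟨⟨(0, id), ⟨rfl, fun v => ⟨0, Subsingleton.elim (α := Fin 1) _ _⟩⟩, fun i => ?_⟩⟩⟩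
      rw [h0, childCount_eq_sum]
      refine Finset.sum_eq_zero fun v _ => if_neg fun h => h.1 (Subsingleton.elim (α := Fin 1) _ _)
    rw [this]
    simp [h0]
  | succ n ih =>
    intro c hc
    obtain ⟨l, hl⟩ : ∃ l, c l = 0 := by
      by_contra! h
      have : ∑ i : Fin (n+1+1), 1 ≤ ∑ i, c i :=
        Finset.sum_le_sum fun i _ => Nat.one_le_iff_ne_zero.2 (h i)
      simp at this
      omega
    rw [card_step l c hl]
    rw [Fin.sum_univ_succAbove _ l, hl, zero_add] at hc
    rw [Fin.prod_univ_succAbove _ l, hl, Nat.factorial_zero, one_mul, Finset.sum_mul,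
      Nat.factorial_succ]
    refine Eq.trans ?_ (congrArg (· * n.factorial) hc)
    beta_reduce
    rw [Finset.sum_mul]
    refine Finset.sum_congr rfl fun p _ => ?_
    obtain ⟨d, hd'⟩ : ∃ d : Fin (n+1) → ℕ, ∀ i, c (l.succAbove i) = d i := ⟨_, fun _ => rfl⟩
    simp only [hd'] at hc ⊢
    by_cases hp : d p = 0
    · rw [hp, zero_mul]
      have : IsEmpty {t : Fin (n+1) × (Fin (n+1) → Fin (n+1)) //
        IsRootedTree t.1 t.2 ∧ ∀ i, childCount t.1 t.2 i + (if i = p then 1 else 0) = d i} := by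
        refine ⟨fun t => ?_⟩
        have := t.2.2 p
        simp [hp] at this
      simp
    · obtain ⟨k, hk⟩ := Nat.exists_eq_succ_of_ne_zero hp
      have hsum : ∑ i, Function.update d p k i = n := by
        rw [Fintype.sum_eq_add_sum_compl p] at hc ⊢
        have : ∑ i ∈ {p}ᶜ, Function.update d p k i = ∑ i ∈ {p}ᶜ, d i := by
          refine Finset.sum_congr rfl fun i hi => ?_
          rw [Function.update_of_ne (by simpa using hi)]
        rw [this, Function.update_self]
        omega
      have hprod : ∏ i, (d i).factorial = d p * ∏ i, (Function.update d p k i).factorial := by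
        rw [Fintype.prod_eq_mul_prod_compl p, Fintype.prod_eq_mul_prod_compl p]
        have : ∏ i ∈ {p}ᶜ, (Function.update d p k i).factorial = ∏ i ∈ {p}ᶜ, (d i).factorial := by
          refine Finset.prod_congr rfl fun i hi => ?_
          rw [Function.update_of_ne (by simpa using hi)]
        rw [this, Function.update_self, hk, Nat.factorial_succ, mul_assoc]
      rw [hprod, ← ih _ hsum, mul_left_comm]
      congr 2
      refine Nat.card_congr (Equiv.subtypeEquivRight fun t => and_congr_right fun _ =>
        forall_congr' fun i => ?_)
      by_cases hi : i = p
      · subst hi; simp [hk]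
      · simp [hi]

/-- For every sequence `c` of nonnegative integers with `∑ c i = n - 1`, the number of
rooted labeled trees on `Fin n` with child sequence `c` is the multinomial coefficient
`(n-1)! / ∏ i, (c i)!` (stated multiplicatively, avoiding division). -/
theorem rooted_tree_count (n : ℕ) (hn : 1 ≤ n) (c : Fin n → ℕ)
    (hc : ∑ i, c i = n - 1) :
    Nat.card {t : Fin n × (Fin n → Fin n) //
        IsRootedTree t.1 t.2 ∧ ∀ i, childCount t.1 t.2 i = c i}
      * ∏ i, Nat.factorial (c i) = Nat.factorial (n - 1) := by
  obtain ⟨m, rfl⟩ : ∃ m, n = m + 1 := ⟨n - 1, by omega⟩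
  exact main_aux m c hc

end TWG
end

section
/- Let d = (d(1),…,d(n)) be a degree sequence with d(i) ≥ 1 for all i and 2m := ∑_{i=1}^n d(i) ≥ 2n−1. Then the total number of execution paths of Pitman's additive coalescent with degree sequence d equals ∏_{i=1}^{n−1} (2m−n+1−i)(n−i) = (n−1)!·(2m−n)_{n−1}. -/
open Classical Filter

namespace TWG

/-- Half-edges for the degree sequence `d`: vertex `i` carries `d i` half-edges,
encoded as `⟨i, j⟩` for `j : Fin (d i)`; `⟨i, d i - 1⟩` is the root half-edge of `i`. -/
abbrev HE {n : ℕ} (d : Fin n → ℕ) := (i : Fin n) × Fin (d i)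

def IsRootHE {n : ℕ} (d : Fin n → ℕ) (h : HE d) : Prop := (h.2 : ℕ) = d h.1 - 1

def IsNonRootHE {n : ℕ} (d : Fin n → ℕ) (h : HE d) : Prop := (h.2 : ℕ) < d h.1 - 1

/-- A candidate execution path: at each of the `n-1` steps, a pair
(root half-edge `r_k`, non-root half-edge `s_k`) is chosen. -/
abbrev Path {n : ℕ} (d : Fin n → ℕ) := Fin (n - 1) → HE d × HE d

/-- Vertices `a` and `b` lie in the same tree of the forest present at the start of
step `k`, i.e. they are joined by the edges created at steps `j < k`. -/
def SameTree {n : ℕ} {d : Fin n → ℕ} (E : Path d) (k : Fin (n - 1)) (a b : Fin n) : Prop :=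
  Relation.ReflTransGen
    (fun x y => ∃ j, j < k ∧
      (((E j).1.1 = x ∧ (E j).2.1 = y) ∨ ((E j).1.1 = y ∧ (E j).2.1 = x))) a b

/-- `E` is a valid execution path of Pitman's additive coalescent for `d`:
at each step, `r_k` is an as-yet-unpaired root half-edge, `s_k` is an
as-yet-unpaired non-root half-edge, and they lie in different trees of the
current forest. -/
def IsExecPath {n : ℕ} (d : Fin n → ℕ) (E : Path d) : Prop :=
  ∀ k : Fin (n - 1),
    IsRootHE d (E k).1 ∧ IsNonRootHE d (E k).2 ∧
    (∀ j, j < k → (E j).1 ≠ (E k).1) ∧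
    (∀ j, j < k → (E j).2 ≠ (E k).2) ∧
    ¬ SameTree E k (E k).1.1 (E k).2.1

/-- The number of children of vertex `i` in the tree `T(d)` built by `E`. -/
noncomputable def cc {n : ℕ} {d : Fin n → ℕ} (E : Path d) (i : Fin n) : ℕ :=
  Nat.card {k : Fin (n - 1) // (E k).2.1 = i}

/-- `v` is a non-root vertex of the tree built by `E`. -/
def IsNonRootV {n : ℕ} {d : Fin n → ℕ} (E : Path d) (v : Fin n) : Prop :=
  ∃ k, (E k).1.1 = v

/-- The parent of `v` in the tree built by `E` (equal to `v` itself for the root). -/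
noncomputable def parentOf {n : ℕ} {d : Fin n → ℕ} (E : Path d) (v : Fin n) : Fin n :=
  if h : ∃ k, (E k).1.1 = v then (E h.choose).2.1 else v

/-- The tree built by `E` is the rooted tree with root `root` and parent map `par`. -/
def TreeEq {n : ℕ} {d : Fin n → ℕ} (E : Path d) (root : Fin n) (par : Fin n → Fin n) : Prop :=
  (∀ k, par (E k).1.1 = (E k).2.1) ∧ ∀ v, v ≠ root → ∃ k, (E k).1.1 = v

/-- `h` is one of the half-edges paired during the execution path `E`. -/
def UsedIn {n : ℕ} {d : Fin n → ℕ} (E : Path d) (h : HE d) : Prop :=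
  (∃ k, (E k).1 = h) ∨ (∃ k, (E k).2 = h)

/-- `M` pairs up, as a fixed-point-free involution, exactly the half-edges left
unpaired by `E` (its fixed points are exactly the half-edges used by `E`). -/
def IsCompletion {n : ℕ} {d : Fin n → ℕ} (E : Path d) (M : HE d → HE d) : Prop :=
  Function.Involutive M ∧ ∀ h, (M h = h ↔ UsedIn E h)

/-- The number of half-edges at `u`, unpaired by `E`, which `M` matches to a
half-edge at `v`.  For `u ≠ v` this is the number of `M`-edges joining `u` and `v`;
for `u = v` it is twice the number of `M`-loops at `u`. -/
noncomputable def matchCount {n : ℕ} {d : Fin n → ℕ} (E : Path d) (M : HE d → HE d)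
    (u v : Fin n) : ℕ :=
  Nat.card {h : HE d // ¬ UsedIn E h ∧ h.1 = u ∧ (M h).1 = v}

/-- `P(Bin(m, ρ) = a)`. -/
noncomputable def binomP (ρ : ℝ) (m a : ℕ) : ℝ :=
  (m.choose a : ℝ) * ρ ^ a * (1 - ρ) ^ (m - a)



def ST {n k : ℕ} {d : Fin n → ℕ} (E : Fin k → HE d × HE d) (a b : Fin n) : Prop :=
  Relation.ReflTransGen
    (fun x y => ∃ j, (((E j).1.1 = x ∧ (E j).2.1 = y) ∨ ((E j).1.1 = y ∧ (E j).2.1 = x))) a b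

def OkStep {n k : ℕ} {d : Fin n → ℕ} (E : Fin k → HE d × HE d) (p : HE d × HE d) : Prop :=
  IsRootHE d p.1 ∧ IsNonRootHE d p.2 ∧ (∀ j, (E j).1 ≠ p.1) ∧ (∀ j, (E j).2 ≠ p.2) ∧
    ¬ ST E p.1.1 p.2.1

def VPath {n : ℕ} (d : Fin n → ℕ) (k : ℕ) (E : Fin k → HE d × HE d) : Prop :=
  ∀ k : Fin k,
    IsRootHE d (E k).1 ∧ IsNonRootHE d (E k).2 ∧
    (∀ j, j < k → (E j).1 ≠ (E k).1) ∧
    (∀ j, j < k → (E j).2 ≠ (E k).2) ∧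
    ¬ Relation.ReflTransGen
    (fun x y => ∃ j, j < k ∧
      (((E j).1.1 = x ∧ (E j).2.1 = y) ∨ ((E j).1.1 = y ∧ (E j).2.1 = x))) (E k).1.1 (E k).2.1

theorem vpath_succ {n : ℕ} (d : Fin n → ℕ) (k : ℕ) (E : Fin k → HE d × HE d) (p : HE d × HE d) :
    VPath d (k+1) (Fin.snoc (α := fun _ => HE d × HE d) E p) ↔ VPath d k E ∧ OkStep E p := by
  unfold VPath OkStep ST
  rw [Fin.forall_fin_succ']
  simp [Fin.forall_fin_succ', Fin.exists_fin_succ', Fin.castSucc_lt_last, not_lt_of_ge, Fin.le_last]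

theorem ST.symm {n k : ℕ} {d : Fin n → ℕ} {E : Fin k → HE d × HE d} {a b : Fin n}
    (h : ST E a b) : ST E b a := by
  unfold ST at *
  induction h with
  | refl => exact .refl
  | tail _ hs ih =>
    obtain ⟨j, hj⟩ := hs
    exact Relation.ReflTransGen.head ⟨j, hj.symm⟩ ih

theorem st_snoc {n k : ℕ} {d : Fin n → ℕ} (E : Fin k → HE d × HE d) (p : HE d × HE d)
    (a b : Fin n) :
    ST (Fin.snoc (α := fun _ => HE d × HE d) E p : Fin (k+1) → HE d × HE d) a b ↔
      ST E a b ∨ (ST E a p.1.1 ∧ ST E p.2.1 b) ∨ (ST E a p.2.1 ∧ ST E p.1.1 b) := by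
  constructor
  · intro h
    induction h with
    | refl => exact Or.inl .refl
    | tail _ hs ih =>
      rename_i b c _
      rw [Fin.exists_fin_succ'] at hs
      simp only [Fin.snoc_castSucc, Fin.snoc_last] at hs
      rcases hs with hs | hs
      · have tl : ∀ x, ST E x b → ST E x c := fun x hx => Relation.ReflTransGen.tail hx hs
        rcases ih with h | ⟨h, h'⟩ | ⟨h, h'⟩
        · exact Or.inl (tl _ h)
        · exact Or.inr (Or.inl ⟨h, tl _ h'⟩)
        · exact Or.inr (Or.inr ⟨h, tl _ h'⟩)
      · have rf : ∀ x, ST E x x := fun x => .refl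
        rcases hs with ⟨rfl, rfl⟩ | ⟨rfl, rfl⟩
        · rcases ih with h | ⟨h, h'⟩ | ⟨h, h'⟩
          · exact Or.inr (Or.inl ⟨h, rf _⟩)
          · exact Or.inr (Or.inl ⟨h, rf _⟩)
          · exact Or.inl h
        · rcases ih with h | ⟨h, h'⟩ | ⟨h, h'⟩
          · exact Or.inr (Or.inr ⟨h, rf _⟩)
          · exact Or.inl h
          · exact Or.inr (Or.inr ⟨h, rf _⟩)
  · have mono : ∀ x y, ST E x y →
        ST (Fin.snoc (α := fun _ => HE d × HE d) E p : Fin (k+1) → HE d × HE d) x y := by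
      intro x y h
      refine Relation.ReflTransGen.mono ?_ _ _ h
      rintro u v ⟨j, hj⟩
      exact ⟨j.castSucc, by simpa using hj⟩
    have e : ST (Fin.snoc (α := fun _ => HE d × HE d) E p : Fin (k+1) → HE d × HE d)
        p.1.1 p.2.1 := Relation.ReflTransGen.single ⟨Fin.last k, by simp⟩
    have tr : ∀ {x y z}, ST (Fin.snoc (α := fun _ => HE d × HE d) E p : Fin (k+1) → HE d × HE d) x y
       → ST (Fin.snoc (α := fun _ => HE d × HE d) E p : Fin (k+1) → HE d × HE d) y z
       → ST (Fin.snoc (α := fun _ => HE d × HE d) E p : Fin (k+1) → HE d × HE d) x z :=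
      fun h h' => Relation.ReflTransGen.trans h h'
    rintro (h | ⟨h, h'⟩ | ⟨h, h'⟩)
    · exact mono _ _ h
    · exact tr (mono _ _ h) (tr e (mono _ _ h'))
    · exact tr (mono _ _ h) (tr e.symm (mono _ _ h'))

theorem root_ext {n : ℕ} {d : Fin n → ℕ} {x y : HE d} (hx : IsRootHE d x) (hy : IsRootHE d y)
    (h : x.1 = y.1) : x = y := by
  obtain ⟨i, a⟩ := x
  obtain ⟨j, b⟩ := y
  obtain rfl : i = j := h
  unfold IsRootHE at hx hy
  simp only at hx hy
  have : a = b := Fin.ext (by omega)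
  rw [this]

theorem inv_aux {n : ℕ} (d : Fin n → ℕ) (k : ℕ) :
    ∀ E : Fin k → HE d × HE d, VPath d k E →
      Function.Injective (fun j => (E j).1.1) ∧ Function.Injective (fun j => (E j).2) ∧
      (∀ j, IsRootHE d (E j).1) ∧ (∀ j, IsNonRootHE d (E j).2) ∧
      ∀ v, ∃ w, (ST E v w ∧ ∀ j, (E j).1.1 ≠ w) ∧
        ∀ w', ST E v w' → (∀ j, (E j).1.1 ≠ w') → w' = w := by
  intro E hE
  have hr : ∀ j, IsRootHE d (E j).1 := fun j => (hE j).1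
  refine ⟨?_, ?_, hr, fun j => (hE j).2.1, ?_⟩
  · intro i j hij
    have h := root_ext (hr i) (hr j) hij
    rcases lt_trichotomy i j with h' | h' | h'
    · exact absurd h ((hE j).2.2.1 i h')
    · exact h'
    · exact absurd h.symm ((hE i).2.2.1 j h')
  · intro i j h
    rcases lt_trichotomy i j with h' | h' | h'
    · exact absurd h ((hE j).2.2.2.1 i h')
    · exact h'
    · exact absurd h.symm ((hE i).2.2.2.1 j h')
  clear hr
  induction k with
  | zero =>
    intro v
    refine ⟨v, ⟨.refl, fun j => j.elim0⟩, ?_⟩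
    intro w' h _
    unfold ST at h
    cases h with
    | refl => rfl
    | tail _ h => exact h.choose.elim0
  | succ k ih =>
    obtain ⟨E, p, rfl⟩ : ∃ E' p', E = Fin.snoc (α := fun _ => HE d × HE d) E' p' :=
      ⟨_, _, (Fin.snoc_init_self (α := fun _ => HE d × HE d) E).symm⟩
    rw [vpath_succ] at hE
    obtain ⟨hE, hp1, hp2, hp3, hp4, hp5⟩ := hE
    have ih := ih E hE
    have hrp : ∀ j, (E j).1.1 ≠ p.1.1 := fun j h => hp3 j (root_ext (hE j).1 hp1 h)
    have tr : ∀ {x y z}, ST E x y → ST E y z → ST E x z :=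
      fun h h' => Relation.ReflTransGen.trans h h'
    have rf : ∀ x, ST E x x := fun x => .refl
    intro v
    simp only [st_snoc, Fin.forall_fin_succ', Fin.snoc_castSucc, Fin.snoc_last]
    by_cases hv : ST E v p.1.1
    · obtain ⟨w, ⟨h1, h2⟩, h3⟩ := ih p.2.1
      refine ⟨w, ⟨Or.inr (Or.inl ⟨hv, h1⟩), h2, ?_⟩, ?_⟩
      · rintro rfl
        exact hp5 h1.symm
      · rintro w' h ⟨h4, h5⟩
        obtain ⟨u, _, hu⟩ := ih v
        rcases h with h | ⟨_, h⟩ | ⟨h, h'⟩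
        · exact absurd ((hu _ hv hrp).trans (hu _ h h4).symm) h5
        · exact h3 _ h h4
        · exact absurd (tr hv.symm h) hp5
    · obtain ⟨w, ⟨h1, h2⟩, h3⟩ := ih v
      refine ⟨w, ⟨Or.inl h1, h2, ?_⟩, ?_⟩
      · rintro rfl
        exact hv h1
      · rintro w' h ⟨h4, h5⟩
        rcases h with h | ⟨h, _⟩ | ⟨h, h'⟩
        · exact h3 _ h h4
        · exact absurd h hv
        · obtain ⟨u, _, hu⟩ := ih p.1.1
          exact absurd ((hu _ (rf _) hrp).trans (hu _ h' h4).symm) h5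

theorem card_nonroot {n k : ℕ} (d : Fin n → ℕ) (hd : ∀ i, 1 ≤ d i) (E : Fin k → HE d × HE d)
    (h : VPath d k E) :
    Nat.card {s : HE d // IsNonRootHE d s ∧ ∀ j, (E j).2 ≠ s} = (∑ i, d i) - n - k := by
  obtain ⟨-, hi, -, hnr, -⟩ := inv_aux d k E h
  let rt : Fin n → HE d := fun i => ⟨i, ⟨d i - 1, by have := hd i; omega⟩⟩
  have hrt : Function.Injective rt := fun i j hij => congrArg Sigma.fst hij
  have hdisj : Disjoint (Finset.univ.image rt) (Finset.univ.image fun j => (E j).2) := by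
    rw [Finset.disjoint_left]
    intro x hx hx'
    simp only [Finset.mem_image, Finset.mem_univ, true_and] at hx hx'
    obtain ⟨i, rfl⟩ := hx
    obtain ⟨j, hj⟩ := hx'
    have := hnr j
    rw [hj] at this
    simp [IsNonRootHE, rt] at this
  have hset : (Finset.univ.filter fun s : HE d => IsNonRootHE d s ∧ ∀ j, (E j).2 ≠ s)
      = (Finset.univ.image rt ∪ Finset.univ.image fun j => (E j).2)ᶜ := by
    ext s
    simp only [Finset.mem_filter, Finset.mem_univ, true_and, Finset.mem_compl, Finset.mem_union,
      Finset.mem_image, not_or, not_exists]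
    refine and_congr_left fun _ => ?_
    unfold IsNonRootHE
    constructor
    · rintro hs i rfl
      simp [rt] at hs
    · intro hs
      by_contra hc
      apply hs s.1
      refine root_ext (d := d) ?_ ?_ rfl
      · rfl
      · have := s.2.2
        unfold IsRootHE
        omega
  rw [Nat.card_eq_fintype_card, Fintype.card_subtype, hset, Finset.card_compl,
    Finset.card_union_of_disjoint hdisj, Finset.card_image_of_injective _ hrt,
    Finset.card_image_of_injective _ hi]
  simp [Nat.sub_sub]

theorem card_vert {n k : ℕ} (d : Fin n → ℕ) (E : Fin k → HE d × HE d)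
    (h : VPath d k E) (s : Fin n) :
    Nat.card {v : Fin n // (∀ j, (E j).1.1 ≠ v) ∧ ¬ ST E v s} = n - 1 - k := by
  obtain ⟨hi, -, -, -, hu⟩ := inv_aux d k E h
  obtain ⟨w, ⟨h1, h2⟩, h3⟩ := hu s
  have hset : (Finset.univ.filter fun v : Fin n => (∀ j, (E j).1.1 ≠ v) ∧ ¬ ST E v s)
      = ((Finset.univ.image fun j => (E j).1.1)ᶜ).erase w := by
    ext v
    simp only [Finset.mem_filter, Finset.mem_univ, true_and, Finset.mem_compl, Finset.mem_erase,
      Finset.mem_image, not_exists]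
    constructor
    · rintro ⟨ha, hb⟩
      refine ⟨?_, ha⟩
      rintro rfl
      exact hb h1.symm
    · rintro ⟨ha, hb⟩
      exact ⟨hb, fun hc => ha (h3 _ hc.symm hb)⟩
  rw [Nat.card_eq_fintype_card, Fintype.card_subtype, hset, Finset.card_erase_of_mem,
    Finset.card_compl, Finset.card_image_of_injective _ hi]
  · simp only [Fintype.card_fin, Finset.card_univ]
    omega
  · simpa using h2

theorem card_ok {n k : ℕ} (d : Fin n → ℕ) (hd : ∀ i, 1 ≤ d i) (E : Fin k → HE d × HE d)
    (h : VPath d k E) :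
    Nat.card {p // OkStep E p} = ((∑ i, d i) - n - k) * (n - 1 - k) := by
  obtain ⟨-, -, hr, -, -⟩ := inv_aux d k E h
  let e : {p // OkStep E p} ≃ (s : {s : HE d // IsNonRootHE d s ∧ ∀ j, (E j).2 ≠ s}) ×
      {v : Fin n // (∀ j, (E j).1.1 ≠ v) ∧ ¬ ST E v s.1.1} :=
    { toFun := fun p => ⟨⟨p.1.2, p.2.2.1, p.2.2.2.2.1⟩, ⟨p.1.1.1,
        fun j hj => p.2.2.2.1 j (root_ext (hr j) p.2.1 hj), p.2.2.2.2.2⟩⟩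
      invFun := fun q => ⟨(⟨q.2.1, ⟨d q.2.1 - 1, by have := hd q.2.1; omega⟩⟩, q.1.1),
        rfl, q.1.2.1, fun j hj => q.2.2.1 j (congrArg Sigma.fst hj), q.1.2.2, q.2.2.2⟩
      left_inv := by
        rintro ⟨⟨a, b⟩, hp⟩
        refine Subtype.ext (Prod.ext ?_ rfl)
        exact root_ext (d := d) rfl hp.1 rfl
      right_inv := by
        rintro ⟨⟨s, hs⟩, ⟨v, hv⟩⟩
        rfl }
  rw [Nat.card_congr e, Nat.card_sigma]
  simp only [card_vert d E h]
  rw [Finset.sum_const, Finset.card_univ, ← Nat.card_eq_fintype_card, card_nonroot d hd E h,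
    smul_eq_mul]

theorem card_vpath {n : ℕ} (d : Fin n → ℕ) (hd : ∀ i, 1 ≤ d i) (k : ℕ) :
    Nat.card {E // VPath d k E}
      = ∏ j ∈ Finset.range k, ((∑ i, d i) - n - j) * (n - 1 - j) := by
  induction k with
  | zero =>
    rw [Finset.prod_range_zero, Nat.card_eq_one_iff_unique]
    exact ⟨⟨fun a b => Subtype.ext (Subsingleton.elim _ _)⟩, ⟨⟨Fin.elim0, fun j => j.elim0⟩⟩⟩
  | succ k ih =>
    let e : {E // VPath d (k+1) E} ≃ (E : {E // VPath d k E}) × {p // OkStep E.1 p} :=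
      { toFun := fun E =>
          have hE := (vpath_succ d k (Fin.init (α := fun _ => HE d × HE d) E.1)
            (E.1 (Fin.last k))).1 (by
              rw [Fin.snoc_init_self (α := fun _ => HE d × HE d)]; exact E.2)
          ⟨⟨Fin.init (α := fun _ => HE d × HE d) E.1, hE.1⟩, ⟨E.1 (Fin.last k), hE.2⟩⟩
        invFun := fun q => ⟨Fin.snoc (α := fun _ => HE d × HE d) q.1.1 q.2.1,
          (vpath_succ d k _ _).2 ⟨q.1.2, q.2.2⟩⟩
        left_inv := fun E => Subtype.ext (Fin.snoc_init_self (α := fun _ => HE d × HE d) E.1)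
        right_inv := by
          rintro ⟨⟨E, hE⟩, ⟨p, hp⟩⟩
          have h1 : Fin.init (α := fun _ => HE d × HE d)
            (Fin.snoc (α := fun _ => HE d × HE d) E p) = E := Fin.init_snoc _ _
          have h2 : Fin.snoc (α := fun _ => HE d × HE d) E p (Fin.last k) = p := Fin.snoc_last _ _
          simp only [h2]
          congr! }
    rw [Nat.card_congr e, Nat.card_sigma, Finset.prod_range_succ, ← ih]
    rw [Finset.sum_congr rfl fun E _ => card_ok d hd E.1 E.2]
    rw [Finset.sum_const, Finset.card_univ, ← Nat.card_eq_fintype_card, smul_eq_mul]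

/-- The total number of execution paths of Pitman's additive coalescent with degree
sequence `d` equals `∏_{i=1}^{n-1} (2m - n + 1 - i)(n - i) = (n-1)! ⋅ (2m - n)_{n-1}`,
where `2m = ∑ i, d i`. -/
theorem exec_path_count (n : ℕ) (hn : 1 ≤ n) (d : Fin n → ℕ)
    (hd : ∀ i, 1 ≤ d i) (hsum : 2 * n - 1 ≤ ∑ i, d i) :
    Nat.card {E : Path d // IsExecPath d E}
        = ∏ k ∈ Finset.range (n - 1), ((∑ i, d i) - n - k) * (n - 1 - k)
    ∧ Nat.card {E : Path d // IsExecPath d E}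
        = Nat.factorial (n - 1) * Nat.descFactorial ((∑ i, d i) - n) (n - 1) := by
  have h : Nat.card {E : Path d // IsExecPath d E}
      = ∏ k ∈ Finset.range (n - 1), ((∑ i, d i) - n - k) * (n - 1 - k) :=
    card_vpath d hd (n - 1)
  refine ⟨h, ?_⟩
  rw [h, Finset.prod_mul_distrib, ← Nat.descFactorial_eq_prod_range,
    ← Nat.descFactorial_eq_prod_range, Nat.descFactorial_self, mul_comm]

end TWG
end

section
/- Let d = (d(1),…,d(n)) be a degree sequence with d(i) ≥ 1 for all i and 2m := ∑_{i=1}^n d(i) ≥ 2n−1. Then for any fixed rooted tree t with vertex set [n], the probability that Pitman's additive coalescent with degree sequence d produces the tree t is P(T(d) = t) = (1/(2m−n)_{n−1}) · ∏_{i=1}^n (d(i)−1)_{c_t(i)}. -/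
open Classical Filter

namespace TWG

/-- Connectivity using all the edges of a partial path. -/
def Conn {n : ℕ} {d : Fin n → ℕ} {K : ℕ} (E : Fin K → HE d × HE d) (a b : Fin n) : Prop :=
  Relation.ReflTransGen
    (fun x y => ∃ j,
      (((E j).1.1 = x ∧ (E j).2.1 = y) ∨ ((E j).1.1 = y ∧ (E j).2.1 = x))) a b

def ConnLt {n : ℕ} {d : Fin n → ℕ} {K : ℕ} (E : Fin K → HE d × HE d) (k : Fin K)
    (a b : Fin n) : Prop :=
  Relation.ReflTransGen
    (fun x y => ∃ j, j < k ∧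
      (((E j).1.1 = x ∧ (E j).2.1 = y) ∨ ((E j).1.1 = y ∧ (E j).2.1 = x))) a b

/-- Partial execution paths. -/
def ExecK {n : ℕ} {d : Fin n → ℕ} {K : ℕ} (E : Fin K → HE d × HE d) : Prop :=
  ∀ k : Fin K,
    IsRootHE d (E k).1 ∧ IsNonRootHE d (E k).2 ∧
    (∀ j, j < k → (E j).1 ≠ (E k).1) ∧
    (∀ j, j < k → (E j).2 ≠ (E k).2) ∧
    ¬ ConnLt E k (E k).1.1 (E k).2.1

/-- Valid continuations of a partial path. -/
def Valid {n : ℕ} {d : Fin n → ℕ} {K : ℕ} (E : Fin K → HE d × HE d) (p : HE d × HE d) : Prop :=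
  IsRootHE d p.1 ∧ IsNonRootHE d p.2 ∧ (∀ j, (E j).1 ≠ p.1) ∧ (∀ j, (E j).2 ≠ p.2) ∧
    ¬ Conn E p.1.1 p.2.1

lemma root_ext_s2 {n : ℕ} {d : Fin n → ℕ} {a b : HE d} (ha : IsRootHE d a) (hb : IsRootHE d b)
    (h : a.1 = b.1) : a = b := by
  obtain ⟨i, x⟩ := a
  obtain ⟨j, y⟩ := b
  simp only at h
  subst h
  simp only [IsRootHE] at ha hb
  have : x = y := Fin.ext (by omega)
  rw [this]

lemma execK_snoc {n : ℕ} {d : Fin n → ℕ} {K : ℕ} (E : Fin K → HE d × HE d) (p : HE d × HE d) :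
    ExecK (Fin.snoc (α := fun _ => HE d × HE d) E p : Fin (K+1) → HE d × HE d)
      ↔ ExecK E ∧ Valid E p := by
  unfold ExecK Valid Conn ConnLt
  rw [Fin.forall_fin_succ']
  simp only [Fin.exists_fin_succ', Fin.forall_fin_succ', Fin.snoc_castSucc, Fin.snoc_last,
    Fin.castSucc_lt_castSucc_iff, Fin.castSucc_lt_last, lt_irrefl, false_and, or_false,
    true_and, false_imp_iff, and_true, forall_true_left, not_lt_of_ge (Fin.le_last _)]

lemma inj1 {n : ℕ} {d : Fin n → ℕ} {K : ℕ} {E : Fin K → HE d × HE d} (h : ExecK E) :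
    Function.Injective (fun k => (E k).1.1) := by
  intro a b hab
  have hab' : (E a).1 = (E b).1 := root_ext_s2 (h a).1 (h b).1 hab
  rcases lt_trichotomy a b with hl | hl | hl
  · exact absurd hab' ((h b).2.2.1 a hl)
  · exact hl
  · exact absurd hab'.symm ((h a).2.2.1 b hl)

lemma inj2 {n : ℕ} {d : Fin n → ℕ} {K : ℕ} {E : Fin K → HE d × HE d} (h : ExecK E) :
    Function.Injective (fun k => (E k).2) := by
  intro a b hab
  rcases lt_trichotomy a b with hl | hl | hl
  · exact absurd hab ((h b).2.2.2.1 a hl)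
  · exact hl
  · exact absurd hab.symm ((h a).2.2.2.1 b hl)

lemma conn_symm {n : ℕ} {d : Fin n → ℕ} {K : ℕ} {E : Fin K → HE d × HE d} {a b : Fin n}
    (h : Conn E a b) : Conn E b a := by
  induction h with
  | refl => exact Relation.ReflTransGen.refl
  | tail _ h ih =>
    obtain ⟨j, hj⟩ := h
    exact Relation.ReflTransGen.head ⟨j, hj.symm⟩ ih

lemma exists_rho {n : ℕ} {d : Fin n → ℕ} : ∀ {K : ℕ} (E : Fin K → HE d × HE d), ExecK E →
    ∃ ρ : Fin n → Fin n, (∀ a b, Conn E a b ↔ ρ a = ρ b) ∧ (∀ v j, (E j).1.1 ≠ ρ v) ∧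
      (∀ v, (∀ j, (E j).1.1 ≠ v) → ρ v = v) := by
  intro K
  induction K with
  | zero =>
    intro E _
    refine ⟨id, ?_, fun v j => j.elim0, fun v _ => rfl⟩
    intro a b
    constructor
    · intro h
      induction h with
      | refl => rfl
      | tail _ h _ => obtain ⟨j, _⟩ := h; exact j.elim0
    · rintro h
      simp only [id] at h
      subst h
      exact Relation.ReflTransGen.refl
  | succ K ih =>
    intro E' hE'
    obtain ⟨E, p, rfl⟩ : ∃ E p, E' = (Fin.snoc (α := fun _ => HE d × HE d) E p) :=
      ⟨Fin.init E', E' (Fin.last K), (Fin.snoc_init_self E').symm⟩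
    obtain ⟨hE, hp1, hp2, hp3, hp4, hp5⟩ := (execK_snoc E p).1 hE'
    obtain ⟨ρ, h1, h2, h3⟩ := ih E hE
    have hr : ∀ j, (E j).1.1 ≠ p.1.1 := fun j hj => hp3 j (root_ext_s2 (hE j).1 hp1 hj)
    have hρr : ρ p.1.1 = p.1.1 := h3 _ hr
    have hρs : ρ p.2.1 ≠ p.1.1 := by
      intro h; apply hp5; rw [h1, hρr, h]
    have hρρ : ∀ v, ρ (ρ v) = ρ v := fun v => h3 _ (h2 v)
    have hold : ∀ a b, Conn E a b →
        Conn (Fin.snoc (α := fun _ => HE d × HE d) E p : Fin (K+1) → HE d × HE d) a b := by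
      intro a b h
      induction h with
      | refl => exact Relation.ReflTransGen.refl
      | tail _ h ih =>
        obtain ⟨j, hj⟩ := h
        exact Relation.ReflTransGen.tail ih ⟨j.castSucc, by simpa using hj⟩
    have hnew : Conn (Fin.snoc (α := fun _ => HE d × HE d) E p : Fin (K+1) → HE d × HE d)
        p.1.1 p.2.1 :=
      Relation.ReflTransGen.single ⟨Fin.last K, by simp⟩
    have hto : ∀ v, Conn (Fin.snoc (α := fun _ => HE d × HE d) E p : Fin (K+1) → HE d × HE d) v
        (if ρ v = p.1.1 then ρ p.2.1 else ρ v) := by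
      intro v
      have hv : ∀ v, Conn E v (ρ v) := fun v => by rw [h1, hρρ]
      split_ifs with h
      · have a1 := hold _ _ (hv v)
        rw [h] at a1
        exact (a1.trans hnew).trans (hold _ _ (hv _))
      · exact hold _ _ (hv v)
    refine ⟨fun v => if ρ v = p.1.1 then ρ p.2.1 else ρ v, ?_, ?_, ?_⟩
    · intro a b
      constructor
      · intro h
        have key : ∀ x y, ((∃ j, ((E j).1.1 = x ∧ (E j).2.1 = y)) ∨ (p.1.1 = x ∧ p.2.1 = y)) →
            (if ρ x = p.1.1 then ρ p.2.1 else ρ x) = (if ρ y = p.1.1 then ρ p.2.1 else ρ y) := by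
          rintro x y (⟨j, hj⟩ | ⟨rfl, rfl⟩)
          · have : ρ x = ρ y := (h1 x y).1 (Relation.ReflTransGen.single ⟨j, Or.inl hj⟩)
            rw [this]
          · rw [if_pos hρr, if_neg hρs]
        induction h with
        | refl => rfl
        | tail _ h ih =>
          refine ih.trans ?_
          obtain ⟨j, hj⟩ := h
          induction j using Fin.lastCases with
          | last =>
            simp only [Fin.snoc_last] at hj
            rcases hj with hj | hj
            · exact key _ _ (Or.inr hj)
            · exact (key _ _ (Or.inr hj)).symm
          | cast j =>
            simp only [Fin.snoc_castSucc] at hj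
            rcases hj with hj | hj
            · exact key _ _ (Or.inl ⟨j, hj⟩)
            · exact (key _ _ (Or.inl ⟨j, hj⟩)).symm
      · intro h
        have ha := hto a
        simp only at h
        rw [h] at ha
        exact ha.trans (conn_symm (hto b))
    · intro v j
      induction j using Fin.lastCases with
      | last =>
        simp only [Fin.snoc_last]
        split_ifs with h
        · exact hρs.symm
        · exact fun h' => h h'.symm
      | cast j =>
        simp only [Fin.snoc_castSucc]
        split_ifs with h
        · exact h2 _ _
        · exact h2 _ _
    · intro v hv
      rw [Fin.forall_fin_succ'] at hv
      simp only [Fin.snoc_last, Fin.snoc_castSucc] at hv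
      have := h3 v hv.1
      simp only [this]
      rw [if_neg hv.2.symm]

lemma card_compl_range {α : Type*} [Finite α] {K : ℕ} (f : Fin K → α)
    (hf : Function.Injective f) : Nat.card {a // ∀ j, f j ≠ a} = Nat.card α - K := by
  have := Fintype.ofFinite α
  have h1 : {a // ∀ j, f j ≠ a} = {a // a ∉ Finset.univ.image f} := by
    congr 1; ext a; simp
  rw [h1, Nat.card_eq_fintype_card, Nat.card_eq_fintype_card, Fintype.card_subtype_compl,
    Fintype.card_coe, Finset.card_image_of_injective _ hf, Finset.card_univ, Fintype.card_fin]

def nonRootEquiv {n : ℕ} (d : Fin n → ℕ) :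
    {h : HE d // IsNonRootHE d h} ≃ ((i : Fin n) × Fin (d i - 1)) where
  toFun h := ⟨h.1.1, ⟨h.1.2, h.2⟩⟩
  invFun x := ⟨⟨x.1, ⟨x.2, by omega⟩⟩, x.2.2⟩
  left_inv _ := rfl
  right_inv _ := rfl

lemma card_nonRoot {n : ℕ} (d : Fin n → ℕ) (hd : ∀ i, 1 ≤ d i) :
    Nat.card {h : HE d // IsNonRootHE d h} = (∑ i, d i) - n := by
  rw [Nat.card_congr (nonRootEquiv d), Nat.card_sigma]
  simp only [Nat.card_eq_fintype_card, Fintype.card_fin]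
  have : ∑ i, d i = ∑ i, (d i - 1) + n := by
    have h : ∑ i, d i = ∑ i : Fin n, ((d i - 1) + 1) :=
      Finset.sum_congr rfl fun i _ => by have := hd i; omega
    rw [h, Finset.sum_add_distrib]; simp
  omega

lemma card_valid {n : ℕ} {d : Fin n → ℕ} (hd : ∀ i, 1 ≤ d i) {K : ℕ}
    (E : Fin K → HE d × HE d) (hE : ExecK E) :
    Nat.card {p // Valid E p} = ((∑ i, d i) - n - K) * (n - 1 - K) := by
  obtain ⟨ρ, h1, h2, h3⟩ := exists_rho E hE
  let f : Fin K → {h : HE d // IsNonRootHE d h} := fun k => ⟨(E k).2, (hE k).2.1⟩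
  have hf : Function.Injective f := fun a b hab => inj2 hE (congrArg Subtype.val hab)
  have hiff : ∀ i v : Fin n, (∀ j, (E j).1.1 ≠ i) → (Conn E i v ↔ ρ v = i) := by
    intro i v hi
    rw [h1, h3 i hi, eq_comm]
  let e : {p // Valid E p} ≃ ((s : {s : {h : HE d // IsNonRootHE d h} // ∀ j, f j ≠ s}) ×
      {i : Fin n // ∀ j : Fin (K+1),
        (Fin.snoc (α := fun _ => Fin n) (fun k => (E k).1.1) (ρ s.1.1.1) j : Fin n) ≠ i}) :=
    { toFun := fun p => ⟨⟨⟨p.1.2, p.2.2.1⟩, fun j hj => p.2.2.2.2.1 j (congrArg Subtype.val hj)⟩,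
        ⟨p.1.1.1, by
          have hr : ∀ j, (E j).1.1 ≠ p.1.1.1 := fun j hj =>
            p.2.2.2.1 j (root_ext_s2 (hE j).1 p.2.1 hj)
          rw [Fin.forall_fin_succ']
          simp only [Fin.snoc_castSucc, Fin.snoc_last]
          exact ⟨hr, fun h => p.2.2.2.2.2 ((hiff _ _ hr).2 h)⟩⟩⟩
      invFun := fun x => ⟨(⟨x.2.1, ⟨d x.2.1 - 1, by have := hd x.2.1; omega⟩⟩, x.1.1.1), by
          have hx := x.2.2
          rw [Fin.forall_fin_succ'] at hx
          simp only [Fin.snoc_castSucc, Fin.snoc_last] at hx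
          refine ⟨rfl, x.1.1.2, fun j hj => hx.1 j (congrArg Sigma.fst hj),
            fun j hj => x.1.2 j (Subtype.ext hj), fun h => hx.2 ((hiff _ _ hx.1).1 h)⟩⟩
      left_inv := by
        rintro ⟨⟨r, s⟩, hp⟩
        apply Subtype.ext
        refine Prod.ext ?_ rfl
        exact root_ext_s2 rfl hp.1 rfl
      right_inv := fun x => rfl }
  rw [Nat.card_congr e, Nat.card_sigma]
  have hc : ∀ s : {s : {h : HE d // IsNonRootHE d h} // ∀ j, f j ≠ s},
      Nat.card {i : Fin n // ∀ j : Fin (K+1),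
        (Fin.snoc (α := fun _ => Fin n) (fun k => (E k).1.1) (ρ s.1.1.1) j : Fin n) ≠ i}
        = n - 1 - K := by
    intro s
    rw [card_compl_range]
    · simp; omega
    · rw [Fin.snoc_injective_iff]
      refine ⟨inj1 hE, ?_⟩
      rintro ⟨j, hj⟩
      exact h2 _ j hj
  simp only [hc]
  rw [Finset.sum_const, smul_eq_mul, Finset.card_univ, ← Nat.card_eq_fintype_card,
    card_compl_range f hf, card_nonRoot d hd]

lemma card_exec {n : ℕ} {d : Fin n → ℕ} (hd : ∀ i, 1 ≤ d i) (K : ℕ) :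
    Nat.card {E : Fin K → HE d × HE d // ExecK E}
      = Nat.descFactorial ((∑ i, d i) - n) K * Nat.descFactorial (n - 1) K := by
  induction K with
  | zero =>
    have : {E : Fin 0 → HE d × HE d // ExecK E} ≃ Unit :=
      { toFun := fun _ => ()
        invFun := fun _ => ⟨fun j => j.elim0, fun j => j.elim0⟩
        left_inv := fun E => Subtype.ext (funext fun j => j.elim0)
        right_inv := fun _ => rfl }
    rw [Nat.card_congr this]; simp
  | succ K ih =>
    let e : {E : Fin (K+1) → HE d × HE d // ExecK E} ≃
        ((E : {E : Fin K → HE d × HE d // ExecK E}) × {p // Valid E.1 p}) :=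
      { toFun := fun E =>
          have h := (execK_snoc (Fin.init E.1) (E.1 (Fin.last K))).1
            (by rw [Fin.snoc_init_self]; exact E.2)
          ⟨⟨Fin.init E.1, h.1⟩, ⟨E.1 (Fin.last K), h.2⟩⟩
        invFun := fun x => ⟨Fin.snoc (α := fun _ => HE d × HE d) x.1.1 x.2.1,
          (execK_snoc _ _).2 ⟨x.1.2, x.2.2⟩⟩
        left_inv := fun E => Subtype.ext (Fin.snoc_init_self E.1)
        right_inv := by
          rintro ⟨⟨E, hE⟩, ⟨p, hp⟩⟩
          simp only [Fin.snoc_last]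
          congr 1
          · simp
          · congr 1 <;> simp }
    rw [Nat.card_congr e, Nat.card_sigma]
    simp only [fun E : {E : Fin K → HE d × HE d // ExecK E} => card_valid hd E.1 E.2]
    rw [Finset.sum_const, smul_eq_mul, Finset.card_univ, ← Nat.card_eq_fintype_card, ih,
      Nat.descFactorial_succ, Nat.descFactorial_succ]
    ring

/-- In a rooted tree the parent of a non-root vertex is not a descendant. -/
lemma not_desc {n : ℕ} {root : Fin n} {par : Fin n → Fin n} (ht : IsRootedTree root par)
    {v : Fin n} (hv : v ≠ root) (m : ℕ) : par^[m] (par v) ≠ v := by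
  intro h
  have hper : par^[m+1] v = v := h
  obtain ⟨N, hN⟩ := ht.2 v
  have hroot : ∀ a, par^[a] root = root := fun a => Function.iterate_fixed ht.1 a
  have h1 : par^[N * (m+1)] v = v := by
    rw [mul_comm, Function.iterate_mul]
    exact Function.iterate_fixed hper N
  have h2 : par^[N * (m+1)] v = root := by
    have : N * (m+1) = N * m + N := by ring
    rw [this, Function.iterate_add_apply, hN, hroot]
  exact hv (h1.symm.trans h2)

/-- The path built from an ordering of the non-root vertices and a choice of slots. -/
noncomputable def mk {n : ℕ} {d : Fin n → ℕ} (hd : ∀ i, 1 ≤ d i) {root : Fin n}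
    {par : Fin n → Fin n} (σ : Fin (n - 1) ≃ {v : Fin n // v ≠ root})
    (f : (i : Fin n) → ({v : Fin n // v ≠ root ∧ par v = i} ↪ Fin (d i - 1))) : Path d :=
  fun k => (⟨(σ k).1, ⟨d (σ k).1 - 1, by have := hd (σ k).1; omega⟩⟩,
    ⟨par (σ k).1, ⟨f (par (σ k).1) ⟨(σ k).1, (σ k).2, rfl⟩, by omega⟩⟩)

lemma f_eq {n : ℕ} {d : Fin n → ℕ} {root : Fin n} {par : Fin n → Fin n}
    (f : (i : Fin n) → ({v : Fin n // v ≠ root ∧ par v = i} ↪ Fin (d i - 1)))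
    {i j u v : Fin n} (hu : u ≠ root ∧ par u = i) (hv : v ≠ root ∧ par v = j) (hij : i = j)
    (h : (f i ⟨u, hu⟩ : ℕ) = f j ⟨v, hv⟩) : u = v := by
  subst hij
  exact congrArg Subtype.val ((f i).injective (Fin.ext h))

lemma mk_spec {n : ℕ} {d : Fin n → ℕ} (hd : ∀ i, 1 ≤ d i) {root : Fin n}
    {par : Fin n → Fin n} (ht : IsRootedTree root par)
    (σ : Fin (n - 1) ≃ {v : Fin n // v ≠ root})
    (f : (i : Fin n) → ({v : Fin n // v ≠ root ∧ par v = i} ↪ Fin (d i - 1))) :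
    IsExecPath d (mk hd σ f) ∧ TreeEq (mk hd σ f) root par := by
  refine ⟨?_, ⟨fun k => rfl, fun v hv => ⟨σ.symm ⟨v, hv⟩, by simp [mk]⟩⟩⟩
  intro k
  refine ⟨rfl, ?_, ?_, ?_, ?_⟩
  · exact (f (par (σ k).1) ⟨(σ k).1, (σ k).2, rfl⟩).2
  · intro j hj h
    have h' : (σ j).1 = (σ k).1 := congrArg Sigma.fst h
    exact hj.ne (σ.injective (Subtype.ext h'))
  · intro j hj h
    have h1 : par (σ j).1 = par (σ k).1 := congrArg Sigma.fst h
    have h2 := congrArg (fun x : HE d => (x.2 : ℕ)) h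
    have h' : (σ j).1 = (σ k).1 := f_eq f _ _ h1 h2
    exact hj.ne (σ.injective (Subtype.ext h'))
  · intro h
    have key : ∀ x y, SameTree (mk hd σ f) k x y →
        ((∃ m, par^[m] x = (σ k).1) ↔ (∃ m, par^[m] y = (σ k).1)) := by
      have step : ∀ j, j < k → ((∃ m, par^[m] (σ j).1 = (σ k).1) ↔
          (∃ m, par^[m] (par (σ j).1) = (σ k).1)) := by
        intro j hj
        constructor
        · rintro ⟨m, hm⟩
          cases m with
          | zero => exact absurd (σ.injective (Subtype.ext hm)) hj.ne
          | succ m => exact ⟨m, hm⟩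
        · rintro ⟨m, hm⟩
          exact ⟨m + 1, hm⟩
      intro x y hxy
      induction hxy with
      | refl => rfl
      | tail _ h ih =>
        refine ih.trans ?_
        obtain ⟨j, hj, ⟨h1, h2⟩ | ⟨h1, h2⟩⟩ := h
        · rw [← h1, ← h2]; exact step j hj
        · rw [← h1, ← h2]; exact (step j hj).symm
    obtain ⟨m, hm⟩ := (key _ _ h).1 ⟨0, rfl⟩
    exact not_desc ht (σ k).2 m hm

lemma card_tree {n : ℕ} {d : Fin n → ℕ} (hd : ∀ i, 1 ≤ d i) {root : Fin n}
    {par : Fin n → Fin n} (ht : IsRootedTree root par) :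
    Nat.card {E : Path d // IsExecPath d E ∧ TreeEq E root par}
      = (n - 1).factorial * ∏ i, Nat.descFactorial (d i - 1) (childCount root par i) := by
  have hcard : Fintype.card {v : Fin n // v ≠ root} = n - 1 := by
    rw [Fintype.card_subtype_compl]; simp
  let F : (Fin (n - 1) ≃ {v : Fin n // v ≠ root}) ×
      ((i : Fin n) → ({v : Fin n // v ≠ root ∧ par v = i} ↪ Fin (d i - 1))) →
      {E : Path d // IsExecPath d E ∧ TreeEq E root par} :=
    fun x => ⟨mk hd x.1 x.2, mk_spec hd ht x.1 x.2⟩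
  have hF : Function.Bijective F := by
    constructor
    · rintro ⟨σ, f⟩ ⟨τ, g⟩ h
      have h0 : mk hd σ f = mk hd τ g := congrArg Subtype.val h
      have hσ : σ = τ := by
        ext k : 2
        exact congrArg (fun E : Path d => (E k).1.1) h0
      subst hσ
      have hfg : f = g := by
        funext i
        ext ⟨v, hv, rfl⟩
        obtain ⟨k, hk⟩ := σ.surjective ⟨v, hv⟩
        obtain rfl : (σ k).1 = v := congrArg Subtype.val hk
        exact congrArg (fun E : Path d => ((E k).2.2 : ℕ)) h0
      rw [hfg]
    · rintro ⟨E, hE, hT⟩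
      have hKE : ExecK E := hE
      have hne : ∀ k, (E k).1.1 ≠ root := by
        have hsub : Finset.univ.erase root ⊆ Finset.univ.image (fun k => (E k).1.1) := by
          intro v hv
          obtain ⟨k, hk⟩ := hT.2 v (Finset.ne_of_mem_erase hv)
          exact Finset.mem_image.2 ⟨k, Finset.mem_univ _, hk⟩
        have heq := Finset.eq_of_subset_of_card_le hsub (by
          refine Finset.card_image_le.trans ?_
          rw [Finset.card_erase_of_mem (Finset.mem_univ _)]; simp)
        intro k
        have : (E k).1.1 ∈ Finset.univ.erase root := by
          rw [heq]; exact Finset.mem_image_of_mem _ (Finset.mem_univ k)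
        exact Finset.ne_of_mem_erase this
      let σ : Fin (n - 1) ≃ {v : Fin n // v ≠ root} :=
        Equiv.ofBijective (fun k => ⟨(E k).1.1, hne k⟩)
          ⟨fun a b hab => inj1 hKE (congrArg Subtype.val hab), fun v => by
            obtain ⟨k, hk⟩ := hT.2 v.1 v.2
            exact ⟨k, Subtype.ext hk⟩⟩
      have hσ : ∀ k, (σ k).1 = (E k).1.1 := fun k => rfl
      have hpar : ∀ v (hv : v ≠ root), (E (σ.symm ⟨v, hv⟩)).2.1 = par v := by
        intro v hv
        rw [← hT.1, ← hσ]; simp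
      let f : (i : Fin n) → ({v : Fin n // v ≠ root ∧ par v = i} ↪ Fin (d i - 1)) := fun i =>
        ⟨fun v => ⟨(E (σ.symm ⟨v.1, v.2.1⟩)).2.2, by
            have h := (hE (σ.symm ⟨v.1, v.2.1⟩)).2.1
            unfold IsNonRootHE at h
            have h' := (hpar v.1 v.2.1).trans v.2.2
            have h'' := congrArg d h'
            omega⟩, by
          rintro ⟨u, hu⟩ ⟨v, hv⟩ h
          have h' : ((E (σ.symm ⟨u, hu.1⟩)).2.2 : ℕ) = (E (σ.symm ⟨v, hv.1⟩)).2.2 :=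
            congrArg Fin.val h
          have h1 : (E (σ.symm ⟨u, hu.1⟩)).2.1 = (E (σ.symm ⟨v, hv.1⟩)).2.1 := by
            rw [hpar, hpar, hu.2, hv.2]
          have h2 : (E (σ.symm ⟨u, hu.1⟩)).2 = (E (σ.symm ⟨v, hv.1⟩)).2 := by
            refine Sigma.ext h1 ?_
            exact (Fin.heq_ext_iff (congrArg d h1)).2 h'
          have h3 := σ.symm.injective (inj2 hKE h2)
          exact Subtype.ext (Subtype.mk.inj h3)⟩
      refine ⟨(σ, f), Subtype.ext (funext fun k => ?_)⟩
      have hp : par (σ k).1 = (E k).2.1 := hT.1 k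
      refine Prod.ext ?_ ?_
      · exact root_ext_s2 rfl (hE k).1 rfl
      · refine Sigma.ext hp ?_
        refine (Fin.heq_ext_iff (congrArg d hp)).2 ?_
        change ((E (σ.symm (σ k))).2.2 : ℕ) = _
        rw [Equiv.symm_apply_apply]
  rw [← Nat.card_eq_of_bijective F hF, Nat.card_prod, Nat.card_pi]
  congr 1
  · rw [Nat.card_eq_fintype_card, Fintype.card_equiv (Fintype.equivOfCardEq (by simp [hcard]))]
    simp
  · refine Finset.prod_congr rfl fun i _ => ?_
    rw [Nat.card_eq_fintype_card, Fintype.card_embedding_eq, childCount,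
      Nat.card_eq_fintype_card]
    simp

/-- For any fixed rooted tree `t = (root, par)` on `Fin n`, the probability that
Pitman's additive coalescent with degree sequence `d` produces the tree `t` is
`(1/(2m - n)_{n-1}) ⋅ ∏ i, (d i - 1)_{c_t(i)}`, where `2m = ∑ i, d i`.  (The law of
the process is the uniform distribution on its execution paths.) -/
theorem tree_probability (n : ℕ) (hn : 1 ≤ n) (d : Fin n → ℕ)
    (hd : ∀ i, 1 ≤ d i) (hsum : 2 * n - 1 ≤ ∑ i, d i)
    (root : Fin n) (par : Fin n → Fin n) (ht : IsRootedTree root par) :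
    (Nat.card {E : Path d // IsExecPath d E ∧ TreeEq E root par} : ℝ)
        / (Nat.card {E : Path d // IsExecPath d E} : ℝ)
      = (∏ i, (Nat.descFactorial (d i - 1) (childCount root par i) : ℝ))
        / (Nat.descFactorial ((∑ i, d i) - n) (n - 1) : ℝ) := by
  have h1 : Nat.card {E : Path d // IsExecPath d E}
      = Nat.descFactorial ((∑ i, d i) - n) (n - 1) * (n - 1).factorial := by
    rw [← Nat.descFactorial_self (n - 1)]
    exact card_exec hd (n - 1)
  rw [h1, card_tree hd ht]
  have hf : ((n - 1).factorial : ℝ) ≠ 0 := by exact_mod_cast Nat.factorial_ne_zero _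
  push_cast
  rw [mul_comm, mul_div_mul_right _ _ hf]

end TWG
end

section
/- Let d = (d(1),…,d(n)) be a degree sequence with d(i) ≥ 1 for all i and ∑_{i=1}^n d(i) ≥ 2n−1, and let T(d) be the tree built by Pitman's additive coalescent with degree sequence d. Then for any child sequence c = (c(1),…,c(n)) such that the event {c_{T(d)} = c} has positive probability, and any rooted tree t on [n] with child sequence c, P(T(d) = t | c_{T(d)} = c) = (c(1)!·…·c(n)!)/(n−1)!; that is, conditionally given its child sequence, T(d) is uniformly distributed over all rooted trees on [n] with that child sequence. -/
open Classical Filter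

namespace TWG

/-- Connectivity by the first `k` edges. -/
def Cn {n m : ℕ} (v p : Fin m → Fin n) (k : ℕ) (a b : Fin n) : Prop :=
  Relation.ReflTransGen
    (fun x y => ∃ j : Fin m, (j : ℕ) < k ∧ ((v j = x ∧ p j = y) ∨ (v j = y ∧ p j = x))) a b

def Vd {n m : ℕ} (v p : Fin m → Fin n) : Prop :=
  ∀ k : Fin m, (∀ j, j < k → v j ≠ v k) ∧ ¬ Cn v p k (v k) (p k)

lemma Cn_snoc {n m : ℕ} (v : Fin m → Fin n) (x : Fin n) (p : Fin (m+1) → Fin n) (k : ℕ)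
    (hk : k ≤ m) (a b : Fin n) :
    Cn (Fin.snoc v x : Fin (m+1) → Fin n) p k a b ↔ Cn v (fun j => p j.castSucc) k a b := by
  unfold Cn
  have : (fun x_1 y => ∃ j : Fin (m+1), (j : ℕ) < k ∧
      (((Fin.snoc v x : Fin (m+1) → Fin n) j = x_1 ∧ p j = y) ∨
        ((Fin.snoc v x : Fin (m+1) → Fin n) j = y ∧ p j = x_1))) =
      (fun x y => ∃ j : Fin m, (j : ℕ) < k ∧
        ((v j = x ∧ p j.castSucc = y) ∨ (v j = y ∧ p j.castSucc = x))) := by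
    funext y z
    apply propext
    rw [Fin.exists_fin_succ']
    simp only [Fin.snoc_castSucc, Fin.val_castSucc, Fin.snoc_last, Fin.val_last]
    constructor
    · rintro (h | h)
      · exact h
      · omega
    · exact Or.inl
  rw [this]

lemma Vd_snoc {n m : ℕ} (v : Fin m → Fin n) (x : Fin n) (p : Fin (m+1) → Fin n) :
    Vd (Fin.snoc v x : Fin (m+1) → Fin n) p ↔
      Vd v (fun j => p j.castSucc) ∧ (∀ j, v j ≠ x) ∧
        ¬ Cn v (fun j => p j.castSucc) m x (p (Fin.last m)) := by
  unfold Vd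
  rw [Fin.forall_fin_succ']
  simp only [Fin.snoc_castSucc, Fin.snoc_last, Fin.forall_fin_succ', Fin.val_castSucc,
    Fin.val_last, Fin.castSucc_lt_castSucc_iff, Fin.castSucc_lt_last, lt_irrefl]
  rw [Cn_snoc _ _ _ _ le_rfl]
  have h1 : ∀ k : Fin m, Cn (Fin.snoc v x : Fin (m+1) → Fin n) p k (v k) (p k.castSucc) ↔
      Cn v (fun j => p j.castSucc) k (v k) (p k.castSucc) :=
    fun k => Cn_snoc _ _ _ _ k.2.le _ _
  simp only [h1]
  have h2 : ∀ k : Fin m, ¬ (Fin.last m < k.castSucc) := fun k => by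
    simp [Fin.le_last]
  simp [h2]

lemma Cn_symm {n m : ℕ} (v p : Fin m → Fin n) (k : ℕ) {a b : Fin n} (h : Cn v p k a b) :
    Cn v p k b a := by
  unfold Cn at *
  induction h with
  | refl => exact Relation.ReflTransGen.refl
  | tail _ h ih =>
    obtain ⟨j, hj, h⟩ := h
    exact Relation.ReflTransGen.head ⟨j, hj, h.symm⟩ ih

lemma Cn_mono {n m : ℕ} (v p : Fin m → Fin n) {k l : ℕ} (hkl : k ≤ l) {a b : Fin n}
    (h : Cn v p k a b) : Cn v p l a b :=
  by
  unfold Cn at *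
  induction h with
  | refl => exact Relation.ReflTransGen.refl
  | tail _ h ih =>
    obtain ⟨j, hj, h⟩ := h
    exact Relation.ReflTransGen.tail ih ⟨j, hj.trans_le hkl, h⟩

lemma exists_rootmap {n m : ℕ} (v p : Fin m → Fin n) (h : Vd v p) :
    ∃ ρ : Fin n → Fin n, (∀ a b, Cn v p m a b ↔ ρ a = ρ b) ∧
      (∀ a, (∀ j, v j ≠ a) ↔ ρ a = a) ∧ ∀ a, ρ (ρ a) = ρ a := by
  induction m with
  | zero =>
    refine ⟨id, ?_, by simp, by simp⟩
    intro a b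
    constructor
    · intro h
      induction h with
      | refl => rfl
      | tail _ h _ => exact h.choose.elim0
    · rintro rfl
      exact Relation.ReflTransGen.refl
  | succ m ih =>
    obtain ⟨w, x, rfl⟩ : ∃ w : Fin m → Fin n, ∃ x, v = (Fin.snoc w x : Fin (m+1) → Fin n) :=
      ⟨Fin.init v, v (Fin.last m), (Fin.snoc_init_self v).symm⟩
    rw [Vd_snoc] at h
    obtain ⟨h1, h2, h3⟩ := h
    obtain ⟨ρ, r1, r2, r3⟩ := ih _ _ h1
    have hx : ρ x = x := (r2 x).1 h2
    set q := p (Fin.last m) with hq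
    have hxq : x ≠ ρ q := by
      intro h
      exact h3 ((r1 _ _).2 (hx.trans h))
    refine ⟨fun a => if ρ a = x then ρ q else ρ a, ?_, ?_, ?_⟩
    · intro a b
      have e0 : ∀ a b, ρ a = ρ b → Cn (Fin.snoc w x : Fin (m+1) → Fin n) p (m+1) a b :=
        fun a b h => Cn_mono _ _ (Nat.le_succ m) ((Cn_snoc w x p m le_rfl a b).2 ((r1 a b).2 h))
      have e1 : Cn (Fin.snoc w x : Fin (m+1) → Fin n) p (m+1) x q :=
        Relation.ReflTransGen.single ⟨Fin.last m, by simp, Or.inl ⟨by simp, rfl⟩⟩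
      constructor
      · intro h
        induction h with
        | refl => rfl
        | tail _ h ih =>
          rename_i y z _
          refine ih.trans ?_
          obtain ⟨j, hj, h⟩ := h
          have key : (fun a => if ρ a = x then ρ q else ρ a)
              ((Fin.snoc w x : Fin (m+1) → Fin n) j) =
              (fun a => if ρ a = x then ρ q else ρ a) (p j) := by
            induction j using Fin.lastCases with
            | last =>
              simp only [Fin.snoc_last, hx, if_true, ← hq]
              simp
            | cast j =>
              have : ρ (w j) = ρ (p j.castSucc) :=
                (r1 _ _).1 (Relation.ReflTransGen.single ⟨j, j.2, Or.inl ⟨rfl, rfl⟩⟩)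
              simp only [Fin.snoc_castSucc, this]
          rcases h with ⟨rfl, rfl⟩ | ⟨rfl, rfl⟩
          · exact key
          · exact key.symm
      · intro h
        have e2 : ∀ a, Cn (Fin.snoc w x : Fin (m+1) → Fin n) p (m+1) a
            (if ρ a = x then ρ q else ρ a) := by
          intro a
          split_ifs with h
          · exact ((e0 a x (by rw [h, hx])).trans e1).trans (e0 _ _ (r3 q).symm)
          · exact e0 _ _ (r3 a).symm
        have := e2 b
        simp only at h
        rw [← h] at this
        exact (e2 a).trans (Cn_symm _ _ _ this)
    · intro a
      rw [Fin.forall_fin_succ']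
      simp only [Fin.snoc_castSucc, Fin.snoc_last, r2]
      split_ifs with h
      · constructor
        · rintro ⟨h', h''⟩
          exact absurd (h.symm.trans h') h''
        · intro h'
          have := r3 q
          rw [h'] at this
          exact absurd (h.symm.trans (this.trans h'.symm)) hxq
      · constructor
        · exact fun h => h.1
        · intro h'
          exact ⟨h', fun h'' => h (by rw [h', h''])⟩
    · intro a
      have : ρ (if ρ a = x then ρ q else ρ a) = if ρ a = x then ρ q else ρ a := by
        split_ifs <;> exact r3 _
      simp only [this]
      split_ifs <;> rfl

lemma Vd_inj {n m : ℕ} {v p : Fin m → Fin n} (h : Vd v p) : Function.Injective v := by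
  intro a b hab
  rcases lt_trichotomy a b with h' | h' | h'
  · exact absurd hab ((h b).1 a h')
  · exact h'
  · exact absurd hab.symm ((h a).1 b h')

lemma card_step_s6 {n m : ℕ} (v p : Fin m → Fin n) (h : Vd v p) (q : Fin n) :
    Nat.card {x : Fin n // (∀ j, v j ≠ x) ∧ ¬ Cn v p m x q} = n - 1 - m := by
  obtain ⟨ρ, r1, r2, r3⟩ := exists_rootmap v p h
  have hset : (Finset.univ.filter fun x : Fin n => (∀ j, v j ≠ x) ∧ ¬ Cn v p m x q) =
      ((Finset.univ.image v)ᶜ).erase (ρ q) := by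
    ext x
    simp only [Finset.mem_filter, Finset.mem_univ, true_and, Finset.mem_erase,
      Finset.mem_compl, Finset.mem_image, not_exists]
    have := r2 x
    have := r1 x q
    constructor
    · rintro ⟨a, b⟩
      refine ⟨fun h => b ?_, a⟩
      rw [r1, h, r3]
    · rintro ⟨a, b⟩
      refine ⟨b, fun h => a ?_⟩
      rw [← (r1 x q).1 h]
      exact ((r2 x).1 b).symm
  rw [Nat.card_eq_fintype_card, Fintype.card_subtype, hset, Finset.card_erase_of_mem,
    Finset.card_compl, Finset.card_image_of_injective _ (Vd_inj h)]
  · simp; omega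
  · simpa using (r2 (ρ q)).2 (r3 q)

lemma card_Vd {n m : ℕ} (p : Fin m → Fin n) :
    Nat.card {v : Fin m → Fin n // Vd v p} = (n - 1).descFactorial m := by
  induction m with
  | zero =>
    rw [Nat.descFactorial_zero, Nat.card_eq_one_iff_unique]
    refine ⟨⟨fun a b => Subtype.ext (Subsingleton.elim _ _)⟩, ⟨⟨Fin.elim0, fun k => k.elim0⟩⟩⟩
  | succ m ih =>
    let p' : Fin m → Fin n := fun j => p j.castSucc
    let e : {v : Fin (m+1) → Fin n // Vd v p} ≃
        (w : {w : Fin m → Fin n // Vd w p'}) ×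
          {x : Fin n // (∀ j, w.1 j ≠ x) ∧ ¬ Cn w.1 p' m x (p (Fin.last m))} :=
      { toFun := fun v =>
          have h := (Vd_snoc (Fin.init v.1) (v.1 (Fin.last m)) p).1
            (by rw [Fin.snoc_init_self]; exact v.2)
          ⟨⟨Fin.init v.1, h.1⟩, ⟨v.1 (Fin.last m), h.2⟩⟩
        invFun := fun w => ⟨Fin.snoc w.1.1 w.2.1, (Vd_snoc _ _ _).2 ⟨w.1.2, w.2.2⟩⟩
        left_inv := fun v => Subtype.ext (Fin.snoc_init_self v.1)
        right_inv := by
          rintro ⟨⟨w, hw⟩, ⟨x, hx⟩⟩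
          have h1 : Fin.init (Fin.snoc w x : Fin (m+1) → Fin n) = w := Fin.init_snoc _ _
          have h2 : (Fin.snoc w x : Fin (m+1) → Fin n) (Fin.last m) = x := Fin.snoc_last _ _
          apply Sigma.ext
          · exact Subtype.ext h1
          · simp only
            congr! 1
            · funext y
              simp only [h1]
            }
    rw [Nat.card_congr e, Nat.card_sigma]
    rw [Finset.sum_congr rfl (fun w _ => card_step_s6 w.1 p' w.2 _)]
    rw [Finset.sum_const, Finset.card_univ, ← Nat.card_eq_fintype_card, ih,
      Nat.descFactorial_succ, smul_eq_mul, mul_comm]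

/-- tree-side conditions -/
def Td {n m : ℕ} (root : Fin n) (par : Fin n → Fin n) (v p : Fin m → Fin n) : Prop :=
  (∀ k, par (v k) = p k) ∧ ∀ w, w ≠ root → ∃ k, v k = w

lemma Td_bij {n : ℕ} (hn : 1 ≤ n) {root : Fin n} {par : Fin n → Fin n} {v p : Fin (n-1) → Fin n}
    (h : Td root par v p) : Function.Injective v ∧ ∀ k, v k ≠ root := by
  have hsub : (Finset.univ.erase root) ⊆ Finset.univ.image v := by
    intro w hw
    obtain ⟨k, hk⟩ := h.2 w (Finset.ne_of_mem_erase hw)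
    exact Finset.mem_image.2 ⟨k, Finset.mem_univ _, hk⟩
  have hc : (Finset.univ.erase root).card = n - 1 := by
    rw [Finset.card_erase_of_mem (Finset.mem_univ _)]; simp
  have hle : (Finset.univ.image v).card ≤ n - 1 := by
    simpa using Finset.card_image_le (s := Finset.univ) (f := v)
  have heq := Finset.eq_of_subset_of_card_le hsub (hle.trans hc.ge)
  constructor
  · have := (Finset.card_image_iff (s := Finset.univ) (f := v)).1 (by rw [← heq, hc]; simp)
    simpa using this
  · intro k hk
    have : v k ∈ Finset.univ.erase root := by
      rw [heq]; exact Finset.mem_image_of_mem _ (Finset.mem_univ _)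
    exact Finset.ne_of_mem_erase this hk

lemma Td_Vd {n : ℕ} (hn : 1 ≤ n) {root : Fin n} {par : Fin n → Fin n} {v p : Fin (n-1) → Fin n}
    (ht : IsRootedTree root par) (h : Td root par v p) : Vd v p := by
  obtain ⟨hi, hr⟩ := Td_bij hn h
  intro k
  refine ⟨fun j hj hjk => hj.ne (hi hjk), fun hC => ?_⟩
  have key : ∀ b, Cn v p k (v k) b → ∃ i, par^[i] b = v k := by
    intro b hb
    induction hb with
    | refl => exact ⟨0, rfl⟩
    | tail _ h' ih =>
      obtain ⟨i, hi'⟩ := ih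
      obtain ⟨j, hj, ⟨rfl, rfl⟩ | ⟨rfl, rfl⟩⟩ := h'
      · cases i with
        | zero =>
          have : j = k := hi hi'
          omega
        | succ i =>
          refine ⟨i, ?_⟩
          rw [Function.iterate_succ_apply, h.1] at hi'
          exact hi'
      · refine ⟨i + 1, ?_⟩
        rw [Function.iterate_succ_apply, h.1]
        exact hi'
  obtain ⟨i, hi'⟩ := key _ hC
  rw [← h.1, ← Function.iterate_succ_apply] at hi'
  obtain ⟨l, hl⟩ := ht.2 (v k)
  have hper : ∀ q, (par^[i+1])^[q] (v k) = v k := fun q => Function.iterate_fixed hi' q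
  have hrt : ∀ q, par^[q] root = root := fun q => Function.iterate_fixed ht.1 q
  have h1 := hper l
  rw [← Function.iterate_mul, show (i+1) * l = i * l + l by ring, Function.iterate_add_apply, hl,
    hrt] at h1
  exact hr k h1.symm

lemma Td_count {n : ℕ} (hn : 1 ≤ n) {root : Fin n} {par : Fin n → Fin n} {v p : Fin (n-1) → Fin n}
    (h : Td root par v p) (i : Fin n) :
    Nat.card {k : Fin (n-1) // p k = i} = childCount root par i := by
  obtain ⟨hi, hr⟩ := Td_bij hn h
  unfold childCount
  refine Nat.card_congr (Equiv.ofBijective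
    (fun k => ⟨v k.1, hr _, by rw [h.1]; exact k.2⟩) ⟨?_, ?_⟩)
  · intro a b hab
    exact Subtype.ext (hi (congrArg Subtype.val hab))
  · rintro ⟨w, hw, hw'⟩
    obtain ⟨k, rfl⟩ := h.2 w hw
    exact ⟨⟨k, by rw [← h.1]; exact hw'⟩, rfl⟩

lemma card_Td {n : ℕ} (hn : 1 ≤ n) (root : Fin n) (par : Fin n → Fin n) (p : Fin (n-1) → Fin n)
    (c : Fin n → ℕ) (hct : ∀ i, childCount root par i = c i)
    (hp : ∀ i, Nat.card {k : Fin (n-1) // p k = i} = c i) :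
    Nat.card {v : Fin (n-1) → Fin n // Td root par v p} = ∏ i, (c i).factorial := by
  have hf : ∀ i, Nonempty ({k : Fin (n-1) // p k = i} ≃
      {w : {w : Fin n // w ≠ root} // par w.1 = i}) := by
    intro i
    have hcd : Nat.card {k : Fin (n-1) // p k = i} =
        Nat.card {w : Fin n // w ≠ root ∧ par w = i} := (hp i).trans (hct i).symm
    refine ⟨((Finite.card_eq.1 hcd).some).trans
      (Equiv.subtypeSubtypeEquivSubtypeInter (fun w => w ≠ root) (fun w => par w = i)).symm⟩
  let e0 : Fin (n-1) ≃ {w : Fin n // w ≠ root} :=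
    Equiv.ofFiberEquiv (f := p) (g := fun w => par w.1) (fun i => (hf i).some)
  have he0 : ∀ k, par (e0 k).1 = p k := fun k =>
    Equiv.ofFiberEquiv_map (f := p) (g := fun w : {w : Fin n // w ≠ root} => par w.1)
      (fun i => (hf i).some) k
  have hcard : Nat.card {g : Equiv.Perm (Fin (n-1)) // p ∘ g = p} = ∏ i, (c i).factorial := by
    rw [Nat.card_eq_fintype_card, DomMulAct.stabilizer_card]
    refine Finset.prod_congr rfl fun i _ => ?_
    rw [← hp i, Nat.card_eq_fintype_card]
  rw [← hcard]
  symm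
  refine Nat.card_congr (Equiv.ofBijective
    (fun g => ⟨fun k => (e0 (g.1 k)).1, ?_, ?_⟩) ⟨?_, ?_⟩)
  · intro k
    rw [he0]; exact congrFun g.2 k
  · intro w hw
    exact ⟨g.1.symm (e0.symm ⟨w, hw⟩), by simp⟩
  · intro a b hab
    apply Subtype.ext
    ext k
    have := congrFun (congrArg Subtype.val hab) k
    exact congrArg _ (e0.injective (Subtype.ext this))
  · rintro ⟨v, hv⟩
    obtain ⟨hi, hr⟩ := Td_bij hn hv
    have hb : Function.Bijective (fun k => e0.symm ⟨v k, hr k⟩) := by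
      rw [← Finite.injective_iff_bijective]
      intro a b hab
      exact hi (congrArg Subtype.val (e0.symm.injective hab))
    refine ⟨⟨Equiv.ofBijective _ hb, ?_⟩, ?_⟩
    · funext k
      simp only [Function.comp, Equiv.ofBijective_apply]
      rw [← he0, Equiv.apply_symm_apply, hv.1]
    · apply Subtype.ext
      funext k
      simp

/-- Sequences of distinct non-root half-edges with vertex counts `c`. -/
def Sd {n : ℕ} (d : Fin n → ℕ) (c : Fin n → ℕ) (s : Fin (n-1) → HE d) : Prop :=
  (∀ k, IsNonRootHE d (s k)) ∧ (∀ k j, j < k → s j ≠ s k) ∧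
    ∀ i, Nat.card {k : Fin (n-1) // (s k).1 = i} = c i

lemma card_fib {n : ℕ} (d : Fin n → ℕ) (hd : ∀ i, 1 ≤ d i) (c : Fin n → ℕ) (X : Path d → Prop)
    (Q : (Fin (n-1) → Fin n) → (Fin (n-1) → Fin n) → Prop) (N : ℕ)
    (hX : ∀ E, X E ↔ (∀ k, IsRootHE d (E k).1) ∧ Sd d c (fun k => (E k).2) ∧
      Q (fun k => (E k).1.1) (fun k => (E k).2.1))
    (hN : ∀ s, Sd d c s → Nat.card {v // Q v (fun k => (s k).1)} = N) :
    Nat.card {E : Path d // X E} = Nat.card {s // Sd d c s} * N := by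
  let rh : Fin n → HE d := fun i => ⟨i, ⟨d i - 1, by have := hd i; omega⟩⟩
  have hrh : ∀ h, IsRootHE d h → rh h.1 = h := by
    rintro ⟨i, j⟩ h
    exact Sigma.ext rfl (heq_of_eq (Fin.ext h.symm))
  let e : {E : Path d // X E} ≃ (s : {s // Sd d c s}) × {v // Q v (fun k => (s.1 k).1)} :=
    { toFun := fun E => ⟨⟨fun k => (E.1 k).2, ((hX _).1 E.2).2.1⟩,
        ⟨fun k => (E.1 k).1.1, ((hX _).1 E.2).2.2⟩⟩
      invFun := fun x => ⟨fun k => (rh (x.2.1 k), x.1.1 k),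
        (hX _).2 ⟨fun k => rfl, x.1.2, x.2.2⟩⟩
      left_inv := fun E => Subtype.ext (funext fun k =>
        Prod.ext (hrh _ (((hX _).1 E.2).1 k)) rfl)
      right_inv := fun x => rfl }
  rw [Nat.card_congr e, Nat.card_sigma, Finset.sum_congr rfl (fun s _ => hN s.1 s.2),
    Finset.sum_const, Finset.card_univ, ← Nat.card_eq_fintype_card, smul_eq_mul]

lemma exec_iff {n : ℕ} (d : Fin n → ℕ) (E : Path d) :
    IsExecPath d E ↔ (∀ k, IsRootHE d (E k).1) ∧ (∀ k, IsNonRootHE d (E k).2) ∧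
      (∀ k j, j < k → (E j).2 ≠ (E k).2) ∧ Vd (fun k => (E k).1.1) (fun k => (E k).2.1) := by
  have hst : ∀ k a b, SameTree E k a b ↔ Cn (fun k => (E k).1.1) (fun k => (E k).2.1) k a b :=
    fun k a b => Iff.rfl
  have hroot : ∀ h h' : HE d, IsRootHE d h → IsRootHE d h' → (h = h' ↔ h.1 = h'.1) := by
    rintro ⟨i, j⟩ ⟨i', j'⟩ h h'
    constructor
    · exact fun h => congrArg _ h
    · intro hh
      have hh : i = i' := hh
      subst hh
      exact Sigma.ext rfl (heq_of_eq (Fin.ext (Eq.trans h (Eq.symm h'))))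
  constructor
  · intro h
    refine ⟨fun k => (h k).1, fun k => (h k).2.1, fun k => (h k).2.2.2.1, fun k =>
      ⟨fun j hj hjk => (h k).2.2.1 j hj ((hroot _ _ (h j).1 (h k).1).2 hjk), (h k).2.2.2.2⟩⟩
  · rintro ⟨h1, h2, h3, h4⟩ k
    exact ⟨h1 k, h2 k, fun j hj hjk => (h4 k).1 j hj ((hroot _ _ (h1 j) (h1 k)).1 hjk), h3 k,
      (h4 k).2⟩

/-- Conditionally given its child sequence `c`, the tree `T(d)` built by Pitman's
additive coalescent is uniform over all rooted trees on `Fin n` with child sequence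
`c`: for any such tree `t = (root, par)`,
`P(T(d) = t | c_{T(d)} = c) = (∏ i, (c i)!) / (n-1)!`. -/
theorem tree_conditionally_uniform (n : ℕ) (hn : 1 ≤ n) (d : Fin n → ℕ)
    (hd : ∀ i, 1 ≤ d i) (hsum : 2 * n - 1 ≤ ∑ i, d i)
    (c : Fin n → ℕ)
    (hpos : Nat.card {E : Path d // IsExecPath d E ∧ ∀ i, cc E i = c i} ≠ 0)
    (root : Fin n) (par : Fin n → Fin n) (ht : IsRootedTree root par)
    (hct : ∀ i, childCount root par i = c i) :
    (Nat.card {E : Path d // IsExecPath d E ∧ TreeEq E root par} : ℝ)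
        / (Nat.card {E : Path d // IsExecPath d E ∧ ∀ i, cc E i = c i} : ℝ)
      = (∏ i, (Nat.factorial (c i) : ℝ)) / (Nat.factorial (n - 1) : ℝ) := by
  have hA := card_fib d hd c (fun E => IsExecPath d E ∧ TreeEq E root par)
    (Td root par) (∏ i, (c i).factorial) (by
      intro E
      rw [exec_iff]
      have hT : TreeEq E root par ↔ Td root par (fun k => (E k).1.1) (fun k => (E k).2.1) :=
        Iff.rfl
      rw [hT]
      constructor
      · rintro ⟨⟨h1, h2, h3, h4⟩, h5⟩
        exact ⟨h1, ⟨h2, h3, fun i => (Td_count hn h5 i).trans (hct i)⟩, h5⟩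
      · rintro ⟨h1, ⟨h2, h3, _⟩, h5⟩
        exact ⟨⟨h1, h2, h3, Td_Vd hn ht h5⟩, h5⟩)
    (fun s hs => card_Td hn root par _ c hct hs.2.2)
  have hB := card_fib d hd c (fun E => IsExecPath d E ∧ ∀ i, cc E i = c i)
    Vd ((n - 1).factorial) (by
      intro E
      rw [exec_iff]
      constructor
      · rintro ⟨⟨h1, h2, h3, h4⟩, h5⟩
        exact ⟨h1, ⟨h2, h3, h5⟩, h4⟩
      · rintro ⟨h1, ⟨h2, h3, h5⟩, h4⟩
        exact ⟨⟨h1, h2, h3, h4⟩, h5⟩)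
    (fun s hs => by rw [card_Vd, Nat.descFactorial_self])
  rw [hB] at hpos
  have hS : (Nat.card {s // Sd d c s} : ℝ) ≠ 0 := by
    exact_mod_cast (Nat.mul_ne_zero_iff.1 hpos).1
  rw [hA, hB]
  push_cast
  rw [mul_div_mul_left _ _ hS]

end TWG
end
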